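/- Let n, n_u, n_y be even positive integers and let Θ_k denote the k×k block-diagonal matrix with 2×2 diagonal blocks J = [[0,1],[−1,0]] (so Θ := Θ_n, and Θᵀ = −Θ = Θ⁻¹). Let Ã ∈ ℝ^{n×n}, B̃_u ∈ ℝ^{n×n_u}, C̃ ∈ ℝ^{n_y×n} be real matrices, and suppose X ∈ ℝ^{n×n} is a nonsingular real skew-symmetric matrix satisfying the algebraic Riccati equation X B̃_u Θ_{n_u} B̃_uᵀ X − Ãᵀ X − X Ã − C̃ᵀ Θ_{n_y} C̃ = 0. Suppose moreover that X = Tᵀ Θ T for some invertible real matrix T, and define A := TÃT⁻¹, B_u := TB̃_u, C := C̃T⁻¹. Then: (a) for every s ∈ ℂ such that sI − Ã is invertible, sI − A is invertible and C(sI − A)⁻¹B_u = C̃(sI − Ã)⁻¹B̃_u; and (b) Θ A + Aᵀ Θ + Cᵀ Θ_{n_y} C − Θ B_u Θ_{n_u} B_uᵀ Θ = 0. -/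

import Mathlib

open Matrix

/-- Complexification of a real matrix. -/
noncomputable def cmat {k l : Type*} (M : Matrix k l ℝ) : Matrix k l ℂ :=
  M.map Complex.ofReal

/-- The symplectic block `J = [[0,1],[-1,0]]`. -/
def Jmat : Matrix (Fin 2) (Fin 2) ℝ := !![0, 1; -1, 0]

/-- The `2k × 2k` block diagonal matrix `Θ = diag(J, …, J)`. -/
noncomputable def Theta (k : ℕ) : Matrix (Fin 2 × Fin k) (Fin 2 × Fin k) ℝ :=
  Matrix.blockDiagonal fun _ : Fin k => Jmat

theorem cmat_mul {k l m : Type*} [Fintype l] (M : Matrix k l ℝ) (N : Matrix l m ℝ) :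
    cmat (M * N) = cmat M * cmat N :=
  Matrix.map_mul (f := Complex.ofRealHom)

theorem cmat_one {k : Type*} [DecidableEq k] : cmat (1 : Matrix k k ℝ) = 1 :=
  Matrix.map_one _ Complex.ofReal_zero Complex.ofReal_one

/-- Similar realizations have the same resolvent set and the same transfer function. -/
theorem transfer_of_similar {R n m p : Type*} [CommRing R] [Fintype n] [DecidableEq n]
    {T S : Matrix n n R} (hTS : T * S = 1) (hST : S * T = 1) (A : Matrix n n R)
    (B : Matrix n m R) (C : Matrix p n R) (s : R)
    (h : IsUnit (s • (1 : Matrix n n R) - A)) :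
    IsUnit (s • (1 : Matrix n n R) - T * A * S) ∧
      C * S * (s • (1 : Matrix n n R) - T * A * S)⁻¹ * (T * B) =
        C * (s • (1 : Matrix n n R) - A)⁻¹ * B := by
  have hconj : s • (1 : Matrix n n R) - T * A * S = T * (s • (1 : Matrix n n R) - A) * S := by
    rw [mul_sub, sub_mul, mul_smul_comm, smul_mul_assoc, mul_one, hTS]
  have hS : S⁻¹ = T := Matrix.inv_eq_right_inv hST
  have hT : T⁻¹ = S := Matrix.inv_eq_right_inv hTS
  rw [hconj]
  refine ⟨((IsUnit.of_mul_eq_one S hTS).mul h).mul (IsUnit.of_mul_eq_one T hST), ?_⟩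
  rw [Matrix.mul_inv_rev, Matrix.mul_inv_rev, hS, hT]
  calc C * S * (T * ((s • (1 : Matrix n n R) - A)⁻¹ * S)) * (T * B)
      = C * (S * T) * (s • (1 : Matrix n n R) - A)⁻¹ * (S * T) * B := by
        simp only [Matrix.mul_assoc]
    _ = C * (s • (1 : Matrix n n R) - A)⁻¹ * B := by
        rw [hST, Matrix.mul_one, Matrix.mul_one]

/-- Congruence by `S = T⁻¹` turns the Riccati expression at `Tᵀ * J * T` into the negated
realizability expression of the transformed realization. -/
theorem riccati_congruence {R n m p : Type*} [CommRing R] [Fintype n] [DecidableEq n] [Fintype m]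
    [Fintype p] {T S : Matrix n n R} (hTS : T * S = 1) (J A : Matrix n n R) (B : Matrix n m R)
    (C : Matrix p n R) (K : Matrix m m R) (L : Matrix p p R) :
    J * (T * A * S) + (T * A * S)ᵀ * J + (C * S)ᵀ * L * (C * S)
        - J * (T * B) * K * (T * B)ᵀ * J =
      -(Sᵀ * ((Tᵀ * J * T) * B * K * Bᵀ * (Tᵀ * J * T) - Aᵀ * (Tᵀ * J * T)
        - (Tᵀ * J * T) * A - Cᵀ * L * C) * S) := by
  have hleft (M : Matrix n n R) : Sᵀ * (Tᵀ * M) = M := by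
    rw [← Matrix.mul_assoc, ← Matrix.transpose_mul, hTS, Matrix.transpose_one, Matrix.one_mul]
  simp only [Matrix.transpose_mul, Matrix.mul_sub, Matrix.sub_mul, Matrix.mul_assoc, hleft, hTS,
    Matrix.mul_one]
  abel

/-- Physical realizability via a Riccati equation with a skew-symmetric solution: if the
nonsingular real skew-symmetric `X` solves the stated ARE and `X = Tᵀ Θ T` with `T` invertible,
then the similarity-transformed realization `(A, B_u, C)` has the same transfer function as
`(Ã, B̃_u, C̃)` and satisfies the physical realizability identity
`Θ A + Aᵀ Θ + Cᵀ Θ_{n_y} C - Θ B_u Θ_{n_u} B_uᵀ Θ = 0`. -/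
theorem stmt_11 {k ku ky : ℕ} (hk : 0 < k) (hku : 0 < ku) (hky : 0 < ky)
    (Atil : Matrix (Fin 2 × Fin k) (Fin 2 × Fin k) ℝ)
    (Butil : Matrix (Fin 2 × Fin k) (Fin 2 × Fin ku) ℝ)
    (Ctil : Matrix (Fin 2 × Fin ky) (Fin 2 × Fin k) ℝ)
    (X : Matrix (Fin 2 × Fin k) (Fin 2 × Fin k) ℝ)
    (hXns : IsUnit X) (hXskew : Xᵀ = -X)
    (hric : X * Butil * Theta ku * Butilᵀ * X - Atilᵀ * X - X * Atil
      - Ctilᵀ * Theta ky * Ctil = 0)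
    (T : Matrix (Fin 2 × Fin k) (Fin 2 × Fin k) ℝ) (hT : IsUnit T)
    (hXT : X = Tᵀ * Theta k * T)
    (A : Matrix (Fin 2 × Fin k) (Fin 2 × Fin k) ℝ) (hA : A = T * Atil * T⁻¹)
    (Bu : Matrix (Fin 2 × Fin k) (Fin 2 × Fin ku) ℝ) (hBu : Bu = T * Butil)
    (C : Matrix (Fin 2 × Fin ky) (Fin 2 × Fin k) ℝ) (hC : C = Ctil * T⁻¹) :
    (∀ s : ℂ, IsUnit (s • (1 : Matrix (Fin 2 × Fin k) (Fin 2 × Fin k) ℂ) - cmat Atil) →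
      IsUnit (s • (1 : Matrix (Fin 2 × Fin k) (Fin 2 × Fin k) ℂ) - cmat A) ∧
      cmat C * (s • (1 : Matrix (Fin 2 × Fin k) (Fin 2 × Fin k) ℂ) - cmat A)⁻¹ * cmat Bu =
        cmat Ctil * (s • (1 : Matrix (Fin 2 × Fin k) (Fin 2 × Fin k) ℂ) - cmat Atil)⁻¹
          * cmat Butil) ∧
    Theta k * A + Aᵀ * Theta k + Cᵀ * Theta ky * C
      - Theta k * Bu * Theta ku * Buᵀ * Theta k = 0 := by
  have hdet := (Matrix.isUnit_iff_isUnit_det T).mp hT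
  have hTS := Matrix.mul_nonsing_inv T hdet
  have hST := Matrix.nonsing_inv_mul T hdet
  subst hA hBu hC hXT
  refine ⟨fun s hs => ?_, ?_⟩
  · simp only [cmat_mul]
    exact transfer_of_similar (by rw [← cmat_mul, hTS, cmat_one])
      (by rw [← cmat_mul, hST, cmat_one]) _ _ _ s hs
  · rw [riccati_congruence hTS, hric, Matrix.mul_zero, Matrix.zero_mul, neg_zero]
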